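/- arXiv:2210.04549 — 3 statements merged into one kernel-verified Lean document; each statement's English description precedes it below -/
import Mathlib

section
/- Let I be a d-dimensional pasting shape and n_1,…,n_d ∈ ℕ. The assignment sending a map of pasting shapes f : □[n_1,…,n_d] → I to the tuple (f_1,…,f_d), where f_a(i) := f(0,…,0,i,0,…,0)_a (with i in the a-th coordinate), is a bijection from the set of maps of pasting shapes □[n_1,…,n_d] → I onto the set Hom_I(⊔_{1≤a≤d}[n_a], ℕ) of tuples (f_1,…,f_d) of monotone maps f_a : [n_a] → ℕ such that every box (x,y) with x_a, y_a ∈ im(f_a) for all a lies in I. Moreover this bijection is natural in ([n_1],…,[n_d]) ∈ Δ^{×d}, and every map of pasting shapes f : □[n_1,…,n_d] → I satisfies f(x) = (f_1(x_1),…,f_d(x_d)) for all vertices x. -/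
namespace Pasting

/-- A point of `ℕ^d`. -/
abbrev Vtx (d : ℕ) := Fin d → ℕ

variable {d : ℕ}

/-- `(x, y)` is a box: `x ≤ y` coordinatewise. -/
def IsBoxPair (x y : Vtx d) : Prop := ∀ a, x a ≤ y a

/-- The number of non-degenerate directions of a box. -/
def boxDim (x y : Vtx d) : ℕ := (Finset.univ.filter fun a => x a ≠ y a).card

/-- `(x', y')` is a face of the box `(x, y)`. -/
def IsFaceOf (x' y' x y : Vtx d) : Prop :=
  (∀ a, (x' a = x a ∨ x' a = y a) ∧ (y' a = x a ∨ y' a = y a)) ∧ IsBoxPair x' y'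

/-- Adjacency of boxes: they agree except possibly at one special index where the
second box continues the first; the join is then `(x, y')`. -/
def Adjacent (x y x' y' : Vtx d) : Prop :=
  IsBoxPair x y ∧ IsBoxPair x' y' ∧
  (∀ a, (x a = x' a ∧ y a = y' a) ∨ (x a < y a ∧ y a = x' a ∧ x' a < y' a)) ∧
  ∀ a b, ¬(x a = x' a ∧ y a = y' a) → ¬(x b = x' b ∧ y b = y' b) → a = b

theorem Adjacent.boxPair_join {x y x' y' : Vtx d} (h : Adjacent x y x' y') :
    IsBoxPair x y' := by
  intro a
  have h1 := h.1 a
  have h2 := h.2.1 a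
  rcases h.2.2.1 a with ⟨e1, e2⟩ | ⟨l1, e2, l2⟩ <;> omega

/-- A `d`-dimensional pasting shape: a set of boxes in `ℕ^d` closed under faces and
joins of adjacent boxes. -/
structure PastingShape (d : ℕ) where
  boxes : Set (Vtx d × Vtx d)
  isBox' : ∀ p ∈ boxes, IsBoxPair p.1 p.2
  face_closed' : ∀ p ∈ boxes, ∀ x' y' : Vtx d, IsFaceOf x' y' p.1 p.2 → (x', y') ∈ boxes
  join_closed' : ∀ x y x' y' : Vtx d, (x, y) ∈ boxes → (x', y') ∈ boxes →
    Adjacent x y x' y' → (x, y') ∈ boxes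

namespace PastingShape

theorem ext_boxes : ∀ {I J : PastingShape d}, I.boxes = J.boxes → I = J := by
  rintro ⟨b, _, _, _⟩ ⟨b', _, _, _⟩ rfl
  rfl

/-- Subshape relation. -/
instance : LE (PastingShape d) := ⟨fun I J => I.boxes ⊆ J.boxes⟩

theorem le_iff {I J : PastingShape d} : I ≤ J ↔ I.boxes ⊆ J.boxes := Iff.rfl

theorem le_boxes {I J : PastingShape d} (h : I ≤ J) : I.boxes ⊆ J.boxes := le_iff.mp h

/-- The vertices of a pasting shape. -/
def vertices (I : PastingShape d) : Set (Vtx d) := {x | (x, x) ∈ I.boxes}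

theorem fst_mem_vertices {I : PastingShape d} {x y : Vtx d} (h : (x, y) ∈ I.boxes) :
    x ∈ I.vertices :=
  I.face_closed' _ h x x ⟨fun _ => ⟨Or.inl rfl, Or.inl rfl⟩, fun _ => le_rfl⟩

theorem snd_mem_vertices {I : PastingShape d} {x y : Vtx d} (h : (x, y) ∈ I.boxes) :
    y ∈ I.vertices :=
  I.face_closed' _ h y y ⟨fun _ => ⟨Or.inr rfl, Or.inr rfl⟩, fun _ => le_rfl⟩

end PastingShape

open PastingShape

/-- A map of pasting shapes: a map on vertices carrying boxes to boxes and preserving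
degenerate coordinates. -/
structure Hom (I J : PastingShape d) where
  toFun : I.vertices → J.vertices
  map_box : ∀ x y : I.vertices, ((x : Vtx d), (y : Vtx d)) ∈ I.boxes →
    ((toFun x : Vtx d), (toFun y : Vtx d)) ∈ J.boxes
  map_deg : ∀ x y : I.vertices, ((x : Vtx d), (y : Vtx d)) ∈ I.boxes →
    ∀ a, (x : Vtx d) a = (y : Vtx d) a → (toFun x : Vtx d) a = (toFun y : Vtx d) a

theorem Hom.ext {I J : PastingShape d} {f g : Hom I J} (h : f.toFun = g.toFun) : f = g := by
  cases f; cases g; cases h; rfl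

/-- Identity map of pasting shapes. -/
def Hom.id (I : PastingShape d) : Hom I I :=
  ⟨fun x => x, fun _ _ h => h, fun _ _ _ _ h => h⟩

/-- Composition of maps of pasting shapes. -/
def Hom.comp {I J K : PastingShape d} (g : Hom J K) (f : Hom I J) : Hom I K where
  toFun := g.toFun ∘ f.toFun
  map_box x y h := g.map_box _ _ (f.map_box x y h)
  map_deg x y h a ha := g.map_deg _ _ (f.map_box x y h) a (f.map_deg x y h a ha)

open Classical in
/-- The underlying map on `ℕ^d`, extended by the identity outside the vertices. -/
noncomputable def Hom.vApp {I J : PastingShape d} (f : Hom I J) (x : Vtx d) : Vtx d :=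
  if h : x ∈ I.vertices then (f.toFun ⟨x, h⟩ : Vtx d) else x

theorem Hom.vApp_box {I J : PastingShape d} (f : Hom I J) {p : Vtx d × Vtx d}
    (hp : p ∈ I.boxes) : (f.vApp p.1, f.vApp p.2) ∈ J.boxes := by
  have h1 := fst_mem_vertices hp
  have h2 := snd_mem_vertices hp
  rw [Hom.vApp, Hom.vApp, dif_pos h1, dif_pos h2]
  exact f.map_box ⟨p.1, h1⟩ ⟨p.2, h2⟩ hp

/-- The inclusion of a subshape. -/
def inclHom {F I : PastingShape d} (h : F ≤ I) : Hom F I where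
  toFun x := ⟨(x : Vtx d), le_boxes h x.2⟩
  map_box _ _ hb := le_boxes h hb
  map_deg _ _ _ _ ha := ha

/-- The standard grid `□[n₁,…,n_d]`. -/
def stdGrid (d : ℕ) (n : Vtx d) : PastingShape d where
  boxes := {p | ∀ a, p.1 a ≤ p.2 a ∧ p.2 a ≤ n a}
  isBox' p hp a := (hp a).1
  face_closed' := by
    rintro ⟨x, y⟩ hp x' y' ⟨hf, hbp⟩ a
    refine ⟨hbp a, ?_⟩
    show y' a ≤ n a
    have h1 : x a ≤ y a := (hp a).1
    have h2 : y a ≤ n a := (hp a).2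
    have h3 : y' a = x a ∨ y' a = y a := (hf a).2
    omega
  join_closed' := by
    intro x y x' y' h h' hadj a
    exact ⟨hadj.boxPair_join a, (h' a).2⟩

theorem mem_stdGrid_vertices {n x : Vtx d} :
    x ∈ (stdGrid d n).vertices ↔ ∀ a, x a ≤ n a := by
  show (∀ a, x a ≤ x a ∧ x a ≤ n a) ↔ _
  exact ⟨fun h a => (h a).2, fun h a => ⟨le_rfl, h a⟩⟩

/-- The vertex of the grid sitting at `i` in direction `a` and at `0` elsewhere. -/
def unitVtx (a : Fin d) (i : ℕ) : Vtx d := fun b => if b = a then i else 0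

theorem unitVtx_mem {n : Vtx d} {a : Fin d} {i : ℕ} (h : i ≤ n a) :
    unitVtx a i ∈ (stdGrid d n).vertices := by
  rw [mem_stdGrid_vertices]
  intro b
  unfold unitVtx
  by_cases hb : b = a
  · subst hb; simpa using h
  · simp [hb]

/-- The components `f_a : [n_a] → ℕ` of a map out of a standard grid. -/
def gcpt {n : Vtx d} {I : PastingShape d} (f : Hom (stdGrid d n) I) (a : Fin d)
    (i : Fin (n a + 1)) : ℕ :=
  (f.toFun ⟨unitVtx a i, unitVtx_mem (Nat.lt_succ_iff.mp i.isLt)⟩ : Vtx d) a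

/-- The image `im(f_a)` of the `a`-th component of a map out of a standard grid. -/
def gcptRange {n : Vtx d} {I : PastingShape d} (f : Hom (stdGrid d n) I) (a : Fin d) :
    Set ℕ := Set.range (gcpt f a)

theorem boxDim_self (x : Vtx d) : boxDim x x = 0 := by simp [boxDim]

theorem boxDim_face_le {x' y' x y : Vtx d} (h : IsFaceOf x' y' x y) :
    boxDim x' y' ≤ boxDim x y := by
  apply Finset.card_le_card
  intro a ha
  simp only [Finset.mem_filter, Finset.mem_univ, true_and] at ha ⊢
  have h1 := (h.1 a).1
  have h2 := (h.1 a).2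
  omega

theorem boxDim_join_le {x y x' y' : Vtx d} (h : Adjacent x y x' y') :
    boxDim x y' ≤ boxDim x y := by
  apply Finset.card_le_card
  intro a ha
  simp only [Finset.mem_filter, Finset.mem_univ, true_and] at ha ⊢
  have := h.2.2.1 a
  omega

/-- The `k`-truncation of a pasting shape: its boxes of dimension `≤ k`. -/
def PastingShape.trunc (k : ℕ) (I : PastingShape d) : PastingShape d where
  boxes := {p | p ∈ I.boxes ∧ boxDim p.1 p.2 ≤ k}
  isBox' p hp := I.isBox' p hp.1
  face_closed' p hp x' y' hf :=
    ⟨I.face_closed' p hp.1 x' y' hf, le_trans (boxDim_face_le hf) hp.2⟩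
  join_closed' x y x' y' h h' hadj :=
    ⟨I.join_closed' x y x' y' h.1 h'.1 hadj, le_trans (boxDim_join_le hadj) h.2⟩

/-- Intersection of pasting shapes. -/
def PastingShape.inter (I J : PastingShape d) : PastingShape d where
  boxes := I.boxes ∩ J.boxes
  isBox' p hp := I.isBox' p hp.1
  face_closed' p hp x' y' hf :=
    ⟨I.face_closed' p hp.1 _ _ hf, J.face_closed' p hp.2 _ _ hf⟩
  join_closed' x y x' y' h h' ha :=
    ⟨I.join_closed' _ _ _ _ h.1 h'.1 ha, J.join_closed' _ _ _ _ h.2 h'.2 ha⟩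

theorem unitVtx_mem_trunc {k : ℕ} {n : Vtx d} {a : Fin d} {i : ℕ} (h : i ≤ n a) :
    unitVtx a i ∈ ((stdGrid d n).trunc k).vertices :=
  ⟨unitVtx_mem h, by simp [boxDim]⟩

/-- The components of a map out of a truncated standard grid. -/
def tcpt {k : ℕ} {n : Vtx d} {I : PastingShape d} (f : Hom ((stdGrid d n).trunc k) I)
    (a : Fin d) (i : Fin (n a + 1)) : ℕ :=
  (f.toFun ⟨unitVtx a i, unitVtx_mem_trunc (Nat.lt_succ_iff.mp i.isLt)⟩ : Vtx d) a

/-- The image of the `a`-th component of a map out of a truncated standard grid. -/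
def tcptRange {k : ℕ} {n : Vtx d} {I : PastingShape d} (f : Hom ((stdGrid d n).trunc k) I)
    (a : Fin d) : Set ℕ := Set.range (tcpt f a)

/-- The closure of a set of boxes under faces and joins. -/
inductive BoxClosure (S : Set (Vtx d × Vtx d)) : Vtx d × Vtx d → Prop
  | base {p} : p ∈ S → BoxClosure S p
  | face {p : Vtx d × Vtx d} {x' y' : Vtx d} :
      BoxClosure S p → IsFaceOf x' y' p.1 p.2 → BoxClosure S (x', y')
  | join {x y x' y' : Vtx d} : BoxClosure S (x, y) → BoxClosure S (x', y') →
      Adjacent x y x' y' → BoxClosure S (x, y')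

/-- The smallest pasting shape containing a given set of boxes. -/
def closureShape (S : Set (Vtx d × Vtx d)) (hS : ∀ p ∈ S, IsBoxPair p.1 p.2) :
    PastingShape d where
  boxes := {p | BoxClosure S p}
  isBox' := by
    intro p hp
    induction hp with
    | base h => exact hS _ h
    | face _ hf _ => exact hf.2
    | join _ _ hadj _ _ => exact hadj.boxPair_join
  face_closed' p hp x' y' hf := BoxClosure.face hp hf
  join_closed' x y x' y' h h' ha := BoxClosure.join h h' ha

/-- The union of two pasting shapes: the smallest pasting shape containing both. -/
def union (I J : PastingShape d) : PastingShape d :=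
  closureShape (I.boxes ∪ J.boxes) (by
    rintro p (h | h)
    · exact I.isBox' p h
    · exact J.isBox' p h)

/-- The union of a family of pasting shapes. -/
def iUnionShape {ι : Type} (f : ι → PastingShape d) : PastingShape d :=
  closureShape (⋃ i, (f i).boxes) (by
    intro p hp
    rcases Set.mem_iUnion.mp hp with ⟨i, hi⟩
    exact (f i).isBox' p hi)

/-- The union of a set of pasting shapes. -/
def sUnionShape (S : Set (PastingShape d)) : PastingShape d :=
  closureShape (⋃ I ∈ S, I.boxes) (by
    intro p hp
    rcases Set.mem_iUnion₂.mp hp with ⟨I, _, hI⟩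
    exact I.isBox' p hI)

theorem grid_apply {n : Vtx d} {I : PastingShape d} (f : Hom (stdGrid d n) I)
    (x : (stdGrid d n).vertices) (a : Fin d) :
    (f.toFun x : Vtx d) a =
      gcpt f a ⟨(x : Vtx d) a, Nat.lt_succ_of_le (mem_stdGrid_vertices.mp x.2 a)⟩ := by
  have hmem : unitVtx a ((x : Vtx d) a) ∈ (stdGrid d n).vertices :=
    unitVtx_mem (mem_stdGrid_vertices.mp x.2 a)
  have hbox : (unitVtx a ((x : Vtx d) a), (x : Vtx d)) ∈ (stdGrid d n).boxes := by
    intro b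
    constructor
    · show unitVtx a ((x : Vtx d) a) b ≤ (x : Vtx d) b
      unfold unitVtx
      by_cases hb : b = a
      · subst hb; simp
      · simp [hb]
    · exact mem_stdGrid_vertices.mp x.2 b
  have hdeg := f.map_deg ⟨unitVtx a ((x : Vtx d) a), hmem⟩ x hbox a
    (by unfold unitVtx; simp)
  exact hdeg.symm

theorem gcpt_mono {n : Vtx d} {I : PastingShape d} (f : Hom (stdGrid d n) I) (a : Fin d) :
    Monotone (gcpt f a) := by
  intro i j hij
  have hbox : (unitVtx a (i : ℕ), unitVtx a (j : ℕ)) ∈ (stdGrid d n).boxes := by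
    intro b
    unfold unitVtx
    by_cases hb : b = a
    · subst hb
      simp only [if_pos rfl]
      exact ⟨hij, Nat.lt_succ_iff.mp j.isLt⟩
    · simp [hb]
  have hmem := f.map_box ⟨unitVtx a (i : ℕ), unitVtx_mem (Nat.lt_succ_iff.mp i.isLt)⟩
    ⟨unitVtx a (j : ℕ), unitVtx_mem (Nat.lt_succ_iff.mp j.isLt)⟩ hbox
  exact (I.isBox' _ hmem) a

theorem vApp_coord {n : Vtx d} {I : PastingShape d} (f : Hom (stdGrid d n) I) {x : Vtx d}
    (hx : x ∈ (stdGrid d n).vertices) (a : Fin d) :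
    f.vApp x a = gcpt f a ⟨x a, Nat.lt_succ_of_le (mem_stdGrid_vertices.mp hx a)⟩ := by
  rw [Hom.vApp, dif_pos hx]
  exact grid_apply f ⟨x, hx⟩ a

theorem vApp_coord_eq {n : Vtx d} {I : PastingShape d} (f : Hom (stdGrid d n) I)
    {x x' : Vtx d} (hx : x ∈ (stdGrid d n).vertices) (hx' : x' ∈ (stdGrid d n).vertices)
    (a : Fin d) (h : x a = x' a) : f.vApp x a = f.vApp x' a := by
  rw [vApp_coord f hx a, vApp_coord f hx' a]
  exact congrArg (gcpt f a) (Fin.ext h)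

theorem vApp_coord_le {n : Vtx d} {I : PastingShape d} (f : Hom (stdGrid d n) I)
    {x x' : Vtx d} (hx : x ∈ (stdGrid d n).vertices) (hx' : x' ∈ (stdGrid d n).vertices)
    (a : Fin d) (h : x a ≤ x' a) : f.vApp x a ≤ f.vApp x' a := by
  rw [vApp_coord f hx a, vApp_coord f hx' a]
  exact gcpt_mono f a h

/-- `E` is a `k`-entire subshape of `I` with bounding box `(α, ω)`. -/
structure IsEntireWith (I E : PastingShape d) (k : ℕ) (α ω : Vtx d) : Prop where
  sub : E ≤ I
  boxPair : IsBoxPair α ω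
  dim_eq : boxDim α ω = k
  faces_mem : ∀ x' y' : Vtx d, IsFaceOf x' y' α ω → boxDim x' y' < k → (x', y') ∈ I.boxes
  mem_iff : ∀ p ∈ I.boxes, (p ∈ E.boxes ↔ ∀ a, α a ≤ p.1 a ∧ p.2 a ≤ ω a)

/-- `E` is a `k`-entire subshape of `I`. -/
def IsEntire (I E : PastingShape d) (k : ℕ) : Prop := ∃ α ω, IsEntireWith I E k α ω

/-- `E` is a closed `k`-entire subshape of `I`: its bounding box belongs to `I`. -/
def IsClosedEntire (I E : PastingShape d) (k : ℕ) : Prop :=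
  ∃ α ω, IsEntireWith I E k α ω ∧ (α, ω) ∈ I.boxes

/-- `E` is open (as a `k`-dimensional entire subshape): all its `k`-boxes are degenerate. -/
def IsOpenShape (E : PastingShape d) (k : ℕ) : Prop := ∀ p ∈ E.boxes, boxDim p.1 p.2 < k

/-- `V` is a `k`-vertebra of `I`: a minimal `k`-entire subshape. -/
def IsVertebra (I V : PastingShape d) (k : ℕ) : Prop :=
  IsEntire I V k ∧ ∀ E : PastingShape d, E ≤ V → IsEntire I E k → E = V

/-- `V` is a closed `k`-vertebra of `I`. -/
def IsClosedVertebra (I V : PastingShape d) (k : ℕ) : Prop :=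
  IsVertebra I V k ∧ IsClosedEntire I V k

/-- `V` is an open vertebra (= open `d`-vertebra) of `I`. -/
def IsOpenVertebra (I V : PastingShape d) : Prop := IsVertebra I V d ∧ IsOpenShape V d

/-- A `d`-shaping map: injective, and every non-degenerate `d`-box of the target is the
image of a non-degenerate `d`-box of the source. -/
def IsShaping {I J : PastingShape d} (f : Hom I J) : Prop :=
  Function.Injective f.toFun ∧
  ∀ p ∈ J.boxes, boxDim p.1 p.2 = d →
    ∃ q, ∃ _ : q ∈ I.boxes, boxDim q.1 q.2 = d ∧ (f.vApp q.1, f.vApp q.2) = p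

/-- `f` witnesses `A` to be an open grid. -/
def WitnessesOpenGrid {A : PastingShape d} {n : Vtx d}
    (f : Hom ((stdGrid d n).trunc (d - 1)) A) : Prop :=
  (∀ a, n a ≠ 0) ∧ IsShaping f ∧
  ∀ p ∈ A.boxes, boxDim p.1 p.2 ≤ d - 1 →
    (∀ a, p.1 a ≤ tcpt f a ⟨n a, Nat.lt_succ_self _⟩ ∧
      p.2 a ≤ tcpt f a ⟨n a, Nat.lt_succ_self _⟩) ∧
    ∃ b, p.1 b = p.2 b ∧ p.1 b ∈ tcptRange f b

/-- `f` witnesses `A` to be a closed grid. -/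
def WitnessesClosedGrid {A : PastingShape d} {n : Vtx d} (f : Hom (stdGrid d n) A) : Prop :=
  (∀ a, n a ≠ 0) ∧ IsShaping f ∧
  ∀ p ∈ A.boxes, boxDim p.1 p.2 ≤ d - 1 →
    (∀ a, p.1 a ≤ gcpt f a ⟨n a, Nat.lt_succ_self _⟩ ∧
      p.2 a ≤ gcpt f a ⟨n a, Nat.lt_succ_self _⟩) ∧
    ∃ b, p.1 b = p.2 b ∧ p.1 b ∈ gcptRange f b

def IsOpenGrid (A : PastingShape d) : Prop :=
  ∃ (n : Vtx d) (f : Hom ((stdGrid d n).trunc (d - 1)) A), WitnessesOpenGrid f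

def IsClosedGrid (A : PastingShape d) : Prop :=
  ∃ (n : Vtx d) (f : Hom (stdGrid d n) A), WitnessesClosedGrid f

def IsGrid (A : PastingShape d) : Prop := IsOpenGrid A ∨ IsClosedGrid A

/-- `A` is a grid with corners `c`. -/
def IsGridWithCorners (A : PastingShape d) (c : Fin d → ℕ × ℕ) : Prop :=
  (∃ (n : Vtx d) (f : Hom ((stdGrid d n).trunc (d - 1)) A), WitnessesOpenGrid f ∧
    ∀ a, tcpt f a ⟨0, Nat.succ_pos _⟩ = (c a).1 ∧
      tcpt f a ⟨n a, Nat.lt_succ_self _⟩ = (c a).2) ∨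
  (∃ (n : Vtx d) (f : Hom (stdGrid d n) A), WitnessesClosedGrid f ∧
    ∀ a, gcpt f a ⟨0, Nat.succ_pos _⟩ = (c a).1 ∧
      gcpt f a ⟨n a, Nat.lt_succ_self _⟩ = (c a).2)

/-- `A` is a cell: a grid on the tuple `(1, …, 1)`. -/
def IsCell (A : PastingShape d) : Prop :=
  (∃ f : Hom ((stdGrid d (fun _ => 1)).trunc (d - 1)) A, WitnessesOpenGrid f) ∨
  (∃ f : Hom (stdGrid d (fun _ => 1)) A, WitnessesClosedGrid f)

/-- The boundary of a shape with corners `c`: those boxes degenerate at some index at a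
corner coordinate. -/
def boundary (A : PastingShape d) (c : Fin d → ℕ × ℕ) : PastingShape d where
  boxes := {p | p ∈ A.boxes ∧ ∃ a, p.1 a = p.2 a ∧ (p.1 a = (c a).1 ∨ p.1 a = (c a).2)}
  isBox' p hp := A.isBox' p hp.1
  face_closed' := by
    rintro ⟨x, y⟩ ⟨hA, a, he, hc⟩ x' y' hf
    refine ⟨A.face_closed' _ hA x' y' hf, a, ?_, ?_⟩
    · show x' a = y' a
      have h1 : x' a = x a ∨ x' a = y a := (hf.1 a).1
      have h2 : y' a = x a ∨ y' a = y a := (hf.1 a).2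
      have he' : x a = y a := he
      omega
    · show x' a = (c a).1 ∨ x' a = (c a).2
      have h1 : x' a = x a ∨ x' a = y a := (hf.1 a).1
      have he' : x a = y a := he
      have hc' : x a = (c a).1 ∨ x a = (c a).2 := hc
      omega
  join_closed' := by
    rintro x y x' y' ⟨hA, a, he, hc⟩ ⟨hA', _⟩ hadj
    refine ⟨A.join_closed' _ _ _ _ hA hA' hadj, a, ?_, hc⟩
    show x a = y' a
    have he' : x a = y a := he
    have := hadj.2.2.1 a
    omega

/-- Admittable pasting shapes (with the corners of the initial grid recorded):
built from a grid by successively glueing grids along open vertebrae. -/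
inductive IsAdmittableC : PastingShape d → (Fin d → ℕ × ℕ) → Prop
  | grid {A : PastingShape d} {c : Fin d → ℕ × ℕ} :
      IsGridWithCorners A c → IsAdmittableC A c
  | step {K A : PastingShape d} {c cA : Fin d → ℕ × ℕ} :
      IsAdmittableC K c → IsGridWithCorners A cA →
      PastingShape.inter K A = boundary A cA →
      IsOpenVertebra K (boundary A cA) →
      IsAdmittableC (union K A) c

/-- Admittable pasting shapes. -/
def IsAdmittable (I : PastingShape d) : Prop := ∃ c, IsAdmittableC I c

/-- `(K, J)` is a division pair for `I`, where `J` has corners `cJ`. -/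
structure IsDivisionPair (I K J : PastingShape d) (cJ : Fin d → ℕ × ℕ) : Prop where
  admI : IsAdmittable I
  admK : IsAdmittable K
  admJ : IsAdmittableC J cJ
  subK : K ≤ I
  subJ : J ≤ I
  inter_eq : PastingShape.inter K J = boundary J cJ
  openVert : IsOpenVertebra K (boundary J cJ)
  union_eq : I = union K J

/-- `(A, {J_i})` is a decomposition of `I`. -/
structure IsDecomposition (I A : PastingShape d) {m : ℕ} (J : Fin m → PastingShape d)
    (cJ : Fin m → Fin d → ℕ × ℕ) : Prop where
  openGrid : IsOpenGrid A
  subA : A ≤ I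
  subJ : ∀ i, J i ≤ I
  admJ : ∀ i, IsAdmittableC (J i) (cJ i)
  inter_eq : ∀ i, PastingShape.inter A (J i) = boundary (J i) (cJ i)
  openVert : ∀ i, IsOpenVertebra A (boundary (J i) (cJ i))
  distinct : ∀ i j, boundary (J i) (cJ i) = boundary (J j) (cJ j) → i = j
  union_eq : I = union A (iUnionShape J)

/-- Heights of admittable pasting shapes. -/
inductive HasHeight : PastingShape d → ℕ → Prop
  | cell {I : PastingShape d} : IsCell I → HasHeight I 0
  | step {I A : PastingShape d} {m : ℕ} {J : Fin m → PastingShape d}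
      {cJ : Fin m → Fin d → ℕ × ℕ} {h : ℕ} :
      IsDecomposition I A J cJ → (∀ i, HasHeight (J i) h) → HasHeight I (h + 1)

/-- Expansion of a point of `ℕ^k` to a point of `ℕ^d` along an embedding `e`, using the
constants `c` outside the image of `e`. -/
noncomputable def expandVtx {k : ℕ} (e : Fin k ↪ Fin d) (c : Vtx d) (x : Vtx k) : Vtx d :=
  fun b => if h : ∃ i, e i = b then x h.choose else c b

theorem expandVtx_apply {k : ℕ} (e : Fin k ↪ Fin d) (c : Vtx d) (x : Vtx k) (i : Fin k) :
    expandVtx e c x (e i) = x i := by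
  have h : ∃ j, e j = e i := ⟨i, rfl⟩
  rw [expandVtx, dif_pos h]
  exact congrArg x (e.injective h.choose_spec)

theorem expandVtx_not {k : ℕ} (e : Fin k ↪ Fin d) (c : Vtx d) (x : Vtx k) {b : Fin d}
    (h : ¬∃ i, e i = b) : expandVtx e c x b = c b := dif_neg h

/-- A pasting shape contained in a hyperplane, viewed as a lower-dimensional
pasting shape: `e` enumerates the active directions and `c` records the constants in the
remaining directions. -/
noncomputable def restrictShape {k : ℕ} (e : Fin k ↪ Fin d) (c : Vtx d)
    (E : PastingShape d) : PastingShape k where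
  boxes := {p | (expandVtx e c p.1, expandVtx e c p.2) ∈ E.boxes}
  isBox' := by
    intro p hp i
    have h := E.isBox' _ hp (e i)
    simp only [expandVtx_apply] at h
    exact h
  face_closed' := by
    intro p hp x' y' hface
    refine E.face_closed' _ hp (expandVtx e c x') (expandVtx e c y') ⟨?_, ?_⟩
    · intro b
      by_cases hb : ∃ i, e i = b
      · obtain ⟨i, rfl⟩ := hb
        simp only [expandVtx_apply]
        exact hface.1 i
      · simp [expandVtx_not e c x' hb, expandVtx_not e c y' hb,
          expandVtx_not e c p.1 hb, expandVtx_not e c p.2 hb]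
    · intro b
      by_cases hb : ∃ i, e i = b
      · obtain ⟨i, rfl⟩ := hb
        simp only [expandVtx_apply]
        exact hface.2 i
      · simp [expandVtx_not e c x' hb, expandVtx_not e c y' hb]
  join_closed' := by
    intro x y x' y' h h' hadj
    refine E.join_closed' (expandVtx e c x) (expandVtx e c y) (expandVtx e c x')
      (expandVtx e c y') h h' ⟨?_, ?_, ?_, ?_⟩
    · intro b
      by_cases hb : ∃ i, e i = b
      · obtain ⟨i, rfl⟩ := hb
        simp only [expandVtx_apply]
        exact hadj.1 i
      · simp [expandVtx_not e c x hb, expandVtx_not e c y hb]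
    · intro b
      by_cases hb : ∃ i, e i = b
      · obtain ⟨i, rfl⟩ := hb
        simp only [expandVtx_apply]
        exact hadj.2.1 i
      · simp [expandVtx_not e c x' hb, expandVtx_not e c y' hb]
    · intro b
      by_cases hb : ∃ i, e i = b
      · obtain ⟨i, rfl⟩ := hb
        simp only [expandVtx_apply]
        exact hadj.2.2.1 i
      · left
        rw [expandVtx_not e c x hb, expandVtx_not e c x' hb, expandVtx_not e c y hb,
          expandVtx_not e c y' hb]
        exact ⟨rfl, rfl⟩
    · intro b b' hb hb'
      have hbr : ∃ i, e i = b := by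
        by_contra hcon
        exact hb ⟨by rw [expandVtx_not e c x hcon, expandVtx_not e c x' hcon],
          by rw [expandVtx_not e c y hcon, expandVtx_not e c y' hcon]⟩
      have hbr' : ∃ i, e i = b' := by
        by_contra hcon
        exact hb' ⟨by rw [expandVtx_not e c x hcon, expandVtx_not e c x' hcon],
          by rw [expandVtx_not e c y hcon, expandVtx_not e c y' hcon]⟩
      obtain ⟨i, rfl⟩ := hbr
      obtain ⟨j, rfl⟩ := hbr'
      have hi : ¬(x i = x' i ∧ y i = y' i) := fun hcon => hb
        ⟨by rw [expandVtx_apply, expandVtx_apply, hcon.1],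
         by rw [expandVtx_apply, expandVtx_apply, hcon.2]⟩
      have hj : ¬(x j = x' j ∧ y j = y' j) := fun hcon => hb'
        ⟨by rw [expandVtx_apply, expandVtx_apply, hcon.1],
         by rw [expandVtx_apply, expandVtx_apply, hcon.2]⟩
      exact congrArg e (hadj.2.2.2 i j hi hj)

/-- A composable pasting shape: closed admittable, and all of its closed `k`-entire
subshapes for `k < d`, viewed as `k`-dimensional pasting shapes, are admittable. -/
def IsComposable (I : PastingShape d) : Prop :=
  IsAdmittable I ∧ IsClosedEntire I I d ∧
  ∀ k, k < d → ∀ (E : PastingShape d) (α ω : Vtx d), IsEntireWith I E k α ω →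
    (α, ω) ∈ I.boxes → ∀ e : Fin k ↪ Fin d, Set.range ⇑e = {a | α a ≠ ω a} →
    IsAdmittable (restrictShape e α E)

/-- A locally composable pasting shape: finitely many boxes and all of its closed
`k`-entire subshapes for `1 ≤ k ≤ d`, viewed as `k`-dimensional pasting shapes, are
admittable. -/
def IsLocallyComposable (I : PastingShape d) : Prop :=
  I.boxes.Finite ∧
  ∀ k, 1 ≤ k → k ≤ d → ∀ (E : PastingShape d) (α ω : Vtx d), IsEntireWith I E k α ω →
    (α, ω) ∈ I.boxes → ∀ e : Fin k ↪ Fin d, Set.range ⇑e = {a | α a ≠ ω a} →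
    IsAdmittable (restrictShape e α E)

/-- The map of standard grids induced by a tuple of monotone maps, i.e. by a morphism of
`Δ^{×d}`. -/
def gridOfMono {m n : Vtx d} (φ : ∀ a, Fin (m a + 1) →o Fin (n a + 1)) :
    Hom (stdGrid d m) (stdGrid d n) where
  toFun x := ⟨fun a => (φ a ⟨(x : Vtx d) a, Nat.lt_succ_of_le (mem_stdGrid_vertices.mp x.2 a)⟩ : Fin (n a + 1)),
    mem_stdGrid_vertices.mpr fun a => Nat.lt_succ_iff.mp (φ a _).isLt⟩
  map_box := by
    intro x y h a
    constructor
    · exact (φ a).monotone (by exact (h a).1)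
    · exact Nat.lt_succ_iff.mp (φ a _).isLt
  map_deg := by
    intro x y h a ha
    show ((φ a _ : Fin (n a + 1)) : ℕ) = ((φ a _ : Fin (n a + 1)) : ℕ)
    exact congrArg _ (congrArg (φ a) (Fin.ext ha))

/-- A morphism of nerves of pasting shapes: a natural transformation of `d`-uple
simplicial sets. -/
structure NerveHom (I J : PastingShape d) where
  app : ∀ n : Vtx d, Hom (stdGrid d n) I → Hom (stdGrid d n) J
  naturality : ∀ (m n : Vtx d) (φ : ∀ a, Fin (m a + 1) →o Fin (n a + 1))
      (σ : Hom (stdGrid d n) I),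
    app m (σ.comp (gridOfMono φ)) = (app n σ).comp (gridOfMono φ)

/-- The morphism of nerves induced by a map of pasting shapes. -/
def nerveMap {I J : PastingShape d} (g : Hom I J) : NerveHom I J where
  app n σ := g.comp σ
  naturality m n φ σ := rfl

/-- The simplex `σ` of the nerve is of dimension `≤ k`. -/
def NerveDimLE {I : PastingShape d} {n : Vtx d} (σ : Hom (stdGrid d n) I) (k : ℕ) : Prop :=
  ∃ (m : Vtx d) (φ : ∀ a, Fin (n a + 1) →o Fin (m a + 1)) (τ : Hom (stdGrid d m) I),
    (Finset.univ.filter fun a => m a ≠ 0).card ≤ k ∧ τ.comp (gridOfMono φ) = σ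

/-- The simplex `σ` of the nerve of `I` lands in the subshape `S`. -/
def LandsIn {I : PastingShape d} {n : Vtx d} (σ : Hom (stdGrid d n) I)
    (S : PastingShape d) : Prop :=
  ∀ p ∈ (stdGrid d n).boxes, (σ.vApp p.1, σ.vApp p.2) ∈ S.boxes

/-- The image subshape of a map of pasting shapes. -/
noncomputable def Hom.imageShape {I J : PastingShape d} (f : Hom I J) : PastingShape d :=
  closureShape {q | ∃ p ∈ I.boxes, q = (f.vApp p.1, f.vApp p.2)}
    (by rintro q ⟨p, hp, rfl⟩; exact J.isBox' _ (f.vApp_box hp))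

/-- The `k`-dimensional hyperplane determined by the degenerate directions `D` and the
constants `c`. -/
def hyperplane (D : Finset (Fin d)) (c : Vtx d) : PastingShape d where
  boxes := {p | IsBoxPair p.1 p.2 ∧ ∀ a ∈ D, p.1 a = c a ∧ p.2 a = c a}
  isBox' p hp := hp.1
  face_closed' := by
    rintro ⟨x, y⟩ ⟨hb, hD⟩ x' y' ⟨hf, hbp⟩
    refine ⟨hbp, fun a ha => ?_⟩
    have h1 : x' a = x a ∨ x' a = y a := (hf a).1
    have h2 : y' a = x a ∨ y' a = y a := (hf a).2
    have h3 : x a = c a ∧ y a = c a := hD a ha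
    constructor
    · show x' a = c a
      omega
    · show y' a = c a
      omega
  join_closed' := by
    intro x y x' y' h h' hadj
    refine ⟨hadj.boxPair_join, fun a ha => ?_⟩
    have h3 : x a = c a ∧ y a = c a := h.2 a ha
    have h4 : x' a = c a ∧ y' a = c a := h'.2 a ha
    exact ⟨h3.1, h4.2⟩

/-- The inert inclusion of the `i`-th unit interval in direction `a`. -/
def edgeHom (n : Vtx d) (a : Fin d) (i : ℕ) (hi : i + 1 ≤ n a) :
    Hom (stdGrid d (Function.update n a 1)) (stdGrid d n) where
  toFun x := ⟨fun b => if b = a then (x : Vtx d) b + i else (x : Vtx d) b, by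
    rw [mem_stdGrid_vertices]
    intro b
    have hb := mem_stdGrid_vertices.mp x.2 b
    rw [Function.update_apply] at hb
    by_cases h : b = a
    · rw [if_pos h] at hb ⊢
      subst h
      omega
    · rw [if_neg h] at hb ⊢
      exact hb⟩
  map_box := by
    intro x y hxy b
    have h1 : (x : Vtx d) b ≤ (y : Vtx d) b := (hxy b).1
    have h2 : (y : Vtx d) b ≤ Function.update n a 1 b := (hxy b).2
    rw [Function.update_apply] at h2
    show (if b = a then (x : Vtx d) b + i else (x : Vtx d) b) ≤
        (if b = a then (y : Vtx d) b + i else (y : Vtx d) b) ∧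
      (if b = a then (y : Vtx d) b + i else (y : Vtx d) b) ≤ n b
    by_cases h : b = a
    · subst h
      simp at h2 ⊢
      omega
    · simp only [if_neg h] at h2 ⊢
      exact ⟨h1, h2⟩
  map_deg := by
    intro x y hxy b hb
    show (if b = a then (x : Vtx d) b + i else (x : Vtx d) b) =
      (if b = a then (y : Vtx d) b + i else (y : Vtx d) b)
    by_cases h : b = a
    · simp only [if_pos h, hb]
    · simp only [if_neg h, hb]

/-- The inclusion of the vertex `{e}` of `[1]` in direction `a`. -/
def capHom (n : Vtx d) (a : Fin d) (e : ℕ) (he : e ≤ 1) :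
    Hom (stdGrid d (Function.update n a 0)) (stdGrid d (Function.update n a 1)) where
  toFun x := ⟨fun b => if b = a then e else (x : Vtx d) b, by
    rw [mem_stdGrid_vertices]
    intro b
    have hb := mem_stdGrid_vertices.mp x.2 b
    rw [Function.update_apply] at hb
    rw [Function.update_apply]
    by_cases h : b = a
    · rw [if_pos h, if_pos h]
      exact he
    · rw [if_neg h, if_neg h]
      rw [if_neg h] at hb
      exact hb⟩
  map_box := by
    intro x y hxy b
    have h1 : (x : Vtx d) b ≤ (y : Vtx d) b := (hxy b).1
    have h2 : (y : Vtx d) b ≤ Function.update n a 0 b := (hxy b).2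
    rw [Function.update_apply] at h2
    show (if b = a then e else (x : Vtx d) b) ≤ (if b = a then e else (y : Vtx d) b) ∧
      (if b = a then e else (y : Vtx d) b) ≤ Function.update n a 1 b
    rw [Function.update_apply]
    by_cases h : b = a
    · simp only [if_pos h] at h2 ⊢
      exact ⟨le_rfl, he⟩
    · simp only [if_neg h] at h2 ⊢
      exact ⟨h1, h2⟩
  map_deg := by
    intro x y hxy b hb
    show (if b = a then e else (x : Vtx d) b) = (if b = a then e else (y : Vtx d) b)
    by_cases h : b = a
    · simp only [if_pos h]
    · simp only [if_neg h, hb]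

/-- The set `Hom_I(⊔_a [n_a], ℕ)` of tuples of monotone maps all of whose associated
boxes belong to `I`. -/
def TupleHom (n : Vtx d) (I : PastingShape d) : Type :=
  {F : ∀ a : Fin d, Fin (n a + 1) → ℕ //
    (∀ a, Monotone (F a)) ∧
    ∀ x y : Vtx d, IsBoxPair x y →
      (∀ a, x a ∈ Set.range (F a) ∧ y a ∈ Set.range (F a)) → (x, y) ∈ I.boxes}

/-- The value `i_a(0)` for a map `i : □[1,…,1] → □[n]`. -/
def cpt0 {n : Vtx d} (i : Hom (stdGrid d (fun _ => 1)) (stdGrid d n)) (a : Fin d) : ℕ :=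
  gcpt i a ⟨0, Nat.succ_pos 1⟩

/-- The value `i_a(1)` for a map `i : □[1,…,1] → □[n]`. -/
def cpt1 {n : Vtx d} (i : Hom (stdGrid d (fun _ => 1)) (stdGrid d n)) (a : Fin d) : ℕ :=
  gcpt i a ⟨1, Nat.lt_succ_self 1⟩

theorem cpt0_le_cpt1 {n : Vtx d} (i : Hom (stdGrid d (fun _ => 1)) (stdGrid d n))
    (a : Fin d) : cpt0 i a ≤ cpt1 i a :=
  gcpt_mono i a (by exact Nat.zero_le 1)

theorem cpt0_lt_cpt1 {n : Vtx d} (i : Hom (stdGrid d (fun _ => 1)) (stdGrid d n))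
    (hi : Function.Injective i.toFun) (a : Fin d) : cpt0 i a < cpt1 i a := by
  rcases lt_or_eq_of_le (cpt0_le_cpt1 i a) with h | h
  · exact h
  exfalso
  have h0 : unitVtx (d := d) a 0 ∈ (stdGrid d (fun _ => 1)).vertices :=
    unitVtx_mem (Nat.zero_le 1)
  have h1 : unitVtx (d := d) a 1 ∈ (stdGrid d (fun _ => 1)).vertices :=
    unitVtx_mem (le_refl 1)
  have hbox : (unitVtx (d := d) a 0, unitVtx a 1) ∈ (stdGrid d (fun _ => 1)).boxes := by
    intro b
    show unitVtx a 0 b ≤ unitVtx a 1 b ∧ unitVtx a 1 b ≤ 1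
    unfold unitVtx
    by_cases hb : b = a <;> simp [hb]
  have hdeg : ∀ b, (i.toFun ⟨unitVtx a 0, h0⟩ : Vtx d) b = (i.toFun ⟨unitVtx a 1, h1⟩ : Vtx d) b := by
    intro b
    by_cases hb : b = a
    · subst hb
      exact h
    · exact i.map_deg _ _ hbox b (by unfold unitVtx; simp [hb])
  have := hi (Subtype.ext (funext hdeg))
  have hcon := congrFun (congrArg Subtype.val this) a
  unfold unitVtx at hcon
  simp at hcon

/-- The subshape `⊡[i] ⊂ □[n]` associated with an injective map `i : □[1,…,1] → □[n]`. -/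
def boxdot {n : Vtx d} (i : Hom (stdGrid d (fun _ => 1)) (stdGrid d n))
    (hi : Function.Injective i.toFun) : PastingShape d where
  boxes := {p | p ∈ (stdGrid d n).boxes ∧ ∃ a, p.2 a ≤ cpt0 i a ∨ cpt1 i a ≤ p.1 a}
  isBox' p hp := (stdGrid d n).isBox' p hp.1
  face_closed' := by
    intro p hp x' y' hf
    obtain ⟨hg, a, hc⟩ := hp
    refine ⟨(stdGrid d n).face_closed' _ hg x' y' hf, a, ?_⟩
    have hxy : p.1 a ≤ p.2 a := ((stdGrid d n).isBox' _ hg) a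
    have h1 : x' a = p.1 a ∨ x' a = p.2 a := (hf.1 a).1
    have h2 : y' a = p.1 a ∨ y' a = p.2 a := (hf.1 a).2
    show y' a ≤ cpt0 i a ∨ cpt1 i a ≤ x' a
    omega
  join_closed' := by
    intro x y x' y' h h' hadj
    obtain ⟨hg, a, hca0⟩ := h
    obtain ⟨hg', b, hcb0⟩ := h'
    have hca : y a ≤ cpt0 i a ∨ cpt1 i a ≤ x a := hca0
    have hcb : y' b ≤ cpt0 i b ∨ cpt1 i b ≤ x' b := hcb0
    refine ⟨(stdGrid d n).join_closed' _ _ _ _ hg hg' hadj, ?_⟩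
    show ∃ c, y' c ≤ cpt0 i c ∨ cpt1 i c ≤ x c
    rcases hca with hca | hca
    · rcases hcb with hcb | hcb
      · exact ⟨b, Or.inl hcb⟩
      · rcases hadj.2.2.1 b with ⟨e1, e2⟩ | ⟨l1, e2, l2⟩
        · exact ⟨b, Or.inr (by omega)⟩
        · rcases hadj.2.2.1 a with ⟨e1a, e2a⟩ | ⟨l1a, e2a, l2a⟩
          · exact ⟨a, Or.inl (by omega)⟩
          · have hab : a = b := hadj.2.2.2 a b (by omega) (by omega)
            subst hab
            have := cpt0_lt_cpt1 i hi a
            exfalso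
            omega
    · exact ⟨a, Or.inr hca⟩

/-- The subshape `M^σ_a[i] ⊂ □[n]`:  `σ = false` is the negative side, `σ = true` the
positive one. -/
def Mside {n : Vtx d} (i : Hom (stdGrid d (fun _ => 1)) (stdGrid d n)) (a : Fin d)
    (σ : Bool) : PastingShape d where
  boxes := {p | p ∈ (stdGrid d n).boxes ∧
    if σ then cpt1 i a ≤ p.1 a ∧ cpt1 i a ≤ p.2 a else p.1 a ≤ cpt0 i a ∧ p.2 a ≤ cpt0 i a}
  isBox' p hp := (stdGrid d n).isBox' p hp.1
  face_closed' := by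
    intro p hp x' y' hf
    obtain ⟨hg, hc0⟩ := hp
    refine ⟨(stdGrid d n).face_closed' _ hg x' y' hf, ?_⟩
    have h1 : x' a = p.1 a ∨ x' a = p.2 a := (hf.1 a).1
    have h2 : y' a = p.1 a ∨ y' a = p.2 a := (hf.1 a).2
    cases σ
    · have hc : p.1 a ≤ cpt0 i a ∧ p.2 a ≤ cpt0 i a := hc0
      show x' a ≤ cpt0 i a ∧ y' a ≤ cpt0 i a
      omega
    · have hc : cpt1 i a ≤ p.1 a ∧ cpt1 i a ≤ p.2 a := hc0
      show cpt1 i a ≤ x' a ∧ cpt1 i a ≤ y' a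
      omega
  join_closed' := by
    intro x y x' y' h h' hadj
    obtain ⟨hg, hc0⟩ := h
    obtain ⟨hg', hc0'⟩ := h'
    refine ⟨(stdGrid d n).join_closed' _ _ _ _ hg hg' hadj, ?_⟩
    cases σ
    · have hc : x a ≤ cpt0 i a ∧ y a ≤ cpt0 i a := hc0
      have hc' : x' a ≤ cpt0 i a ∧ y' a ≤ cpt0 i a := hc0'
      show x a ≤ cpt0 i a ∧ y' a ≤ cpt0 i a
      omega
    · have hc : cpt1 i a ≤ x a ∧ cpt1 i a ≤ y a := hc0
      have hc' : cpt1 i a ≤ x' a ∧ cpt1 i a ≤ y' a := hc0'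
      show cpt1 i a ≤ x a ∧ cpt1 i a ≤ y' a
      omega

/-- The subshape `A[i] ⊂ □[n]`: the largest subshape whose vertices lie between the
corners of `i`. -/
def innerShape {n : Vtx d} (i : Hom (stdGrid d (fun _ => 1)) (stdGrid d n)) :
    PastingShape d where
  boxes := {p | p ∈ (stdGrid d n).boxes ∧ ∀ a, cpt0 i a ≤ p.1 a ∧ p.2 a ≤ cpt1 i a}
  isBox' p hp := (stdGrid d n).isBox' p hp.1
  face_closed' := by
    intro p hp x' y' hf
    obtain ⟨hg, hc⟩ := hp
    refine ⟨(stdGrid d n).face_closed' _ hg x' y' hf, fun a => ?_⟩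
    have h1 : x' a = p.1 a ∨ x' a = p.2 a := (hf.1 a).1
    have h2 : y' a = p.1 a ∨ y' a = p.2 a := (hf.1 a).2
    have hc' : cpt0 i a ≤ p.1 a ∧ p.2 a ≤ cpt1 i a := hc a
    have hxy : p.1 a ≤ p.2 a := ((stdGrid d n).isBox' _ hg) a
    show cpt0 i a ≤ x' a ∧ y' a ≤ cpt1 i a
    omega
  join_closed' := by
    intro x y x' y' h h' hadj
    obtain ⟨hg, hc⟩ := h
    obtain ⟨hg', hc'⟩ := h'
    refine ⟨(stdGrid d n).join_closed' _ _ _ _ hg hg' hadj, fun a => ?_⟩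
    exact ⟨(hc a).1, (hc' a).2⟩

/-- The preimage of a subshape under a map out of a standard grid. -/
noncomputable def gridPreimage {n : Vtx d} {I : PastingShape d} (f : Hom (stdGrid d n) I)
    (T : PastingShape d) : PastingShape d where
  boxes := {p | p ∈ (stdGrid d n).boxes ∧ (f.vApp p.1, f.vApp p.2) ∈ T.boxes}
  isBox' p hp := (stdGrid d n).isBox' p hp.1
  face_closed' := by
    intro p hp x' y' hf
    obtain ⟨hg, hT⟩ := hp
    have hg' : (x', y') ∈ (stdGrid d n).boxes := (stdGrid d n).face_closed' _ hg x' y' hf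
    refine ⟨hg', ?_⟩
    have v1 : p.1 ∈ (stdGrid d n).vertices := fst_mem_vertices hg
    have v2 : p.2 ∈ (stdGrid d n).vertices := snd_mem_vertices hg
    have v1' : x' ∈ (stdGrid d n).vertices := fst_mem_vertices hg'
    have v2' : y' ∈ (stdGrid d n).vertices := snd_mem_vertices hg'
    refine T.face_closed' _ hT (f.vApp x') (f.vApp y') ⟨fun a => ⟨?_, ?_⟩, fun a => ?_⟩
    · rcases (hf.1 a).1 with h | h
      · exact Or.inl (vApp_coord_eq f v1' v1 a h)
      · exact Or.inr (vApp_coord_eq f v1' v2 a h)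
    · rcases (hf.1 a).2 with h | h
      · exact Or.inl (vApp_coord_eq f v2' v1 a h)
      · exact Or.inr (vApp_coord_eq f v2' v2 a h)
    · exact vApp_coord_le f v1' v2' a (hf.2 a)
  join_closed' := by
    intro x y x' y' h h' hadj
    obtain ⟨hg, hT⟩ := h
    obtain ⟨hg', hT'⟩ := h'
    have hgj : (x, y') ∈ (stdGrid d n).boxes := (stdGrid d n).join_closed' _ _ _ _ hg hg' hadj
    refine ⟨hgj, ?_⟩
    have vx : x ∈ (stdGrid d n).vertices := fst_mem_vertices hg
    have vy : y ∈ (stdGrid d n).vertices := snd_mem_vertices hg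
    have vx' : x' ∈ (stdGrid d n).vertices := fst_mem_vertices hg'
    have vy' : y' ∈ (stdGrid d n).vertices := snd_mem_vertices hg'
    show (f.vApp x, f.vApp y') ∈ T.boxes
    by_cases hsp : ∃ b, ¬(x b = x' b ∧ y b = y' b)
    · obtain ⟨b, hb⟩ := hsp
      rcases hadj.2.2.1 b with hcb | hcb
      · exact absurd hcb hb
      obtain ⟨l1, e2, l2⟩ := hcb
      by_cases h1 : f.vApp x b = f.vApp y b
      · have hxx' : f.vApp x = f.vApp x' := by
          funext a
          by_cases hab : a = b
          · subst hab
            rw [h1]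
            exact vApp_coord_eq f vy vx' a e2
          · rcases hadj.2.2.1 a with ⟨ea1, ea2⟩ | ⟨la1, ea, la2⟩
            · exact vApp_coord_eq f vx vx' a ea1
            · exact absurd (hadj.2.2.2 a b (by omega) (by omega)) hab
        rw [hxx']
        exact hT'
      · by_cases h2 : f.vApp x' b = f.vApp y' b
        · have hyy' : f.vApp y' = f.vApp y := by
            funext a
            by_cases hab : a = b
            · subst hab
              rw [← h2]
              exact (vApp_coord_eq f vy vx' a e2).symm
            · rcases hadj.2.2.1 a with ⟨ea1, ea2⟩ | ⟨la1, ea, la2⟩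
              · exact vApp_coord_eq f vy' vy a ea2.symm
              · exact absurd (hadj.2.2.2 a b (by omega) (by omega)) hab
          rw [hyy']
          exact hT
        · refine T.join_closed' (f.vApp x) (f.vApp y) (f.vApp x') (f.vApp y') hT hT'
            ⟨?_, ?_, ?_, ?_⟩
          · exact T.isBox' _ hT
          · exact T.isBox' _ hT'
          · intro a
            by_cases hab : a = b
            · subst hab
              right
              refine ⟨?_, vApp_coord_eq f vy vx' a e2, ?_⟩
              · exact lt_of_le_of_ne (vApp_coord_le f vx vy a (le_of_lt l1)) h1
              · exact lt_of_le_of_ne (vApp_coord_le f vx' vy' a (le_of_lt l2)) h2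
            · rcases hadj.2.2.1 a with ⟨ea1, ea2⟩ | ⟨la1, ea, la2⟩
              · exact Or.inl ⟨vApp_coord_eq f vx vx' a ea1, vApp_coord_eq f vy vy' a ea2⟩
              · exact absurd (hadj.2.2.2 a b (by omega) (by omega)) hab
          · intro a a' ha ha'
            have hasb : a = b := by
              by_contra hab
              rcases hadj.2.2.1 a with ⟨ea1, ea2⟩ | ⟨la1, ea, la2⟩
              · exact ha ⟨vApp_coord_eq f vx vx' a ea1, vApp_coord_eq f vy vy' a ea2⟩
              · exact hab (hadj.2.2.2 a b (by omega) (by omega))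
            have hasb' : a' = b := by
              by_contra hab
              rcases hadj.2.2.1 a' with ⟨ea1, ea2⟩ | ⟨la1, ea, la2⟩
              · exact ha' ⟨vApp_coord_eq f vx vx' a' ea1, vApp_coord_eq f vy vy' a' ea2⟩
              · exact hab (hadj.2.2.2 a' b (by omega) (by omega))
            rw [hasb, hasb']
    · push_neg at hsp
      have hy' : y' = y := funext fun b => ((hsp b).2).symm
      rw [hy']
      exact hT

/-- A map `g : □[n] → I` underlies a map of division pairs `(⊡[i], A[i]) → (K, J)`. -/
noncomputable def IsDivPairMap {n : Vtx d} {I : PastingShape d} (K J : PastingShape d)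
    (g : Hom (stdGrid d n) I) (i : Hom (stdGrid d (fun _ => 1)) (stdGrid d n))
    (hi : Function.Injective i.toFun) : Prop :=
  gridPreimage g J = innerShape i ∧
  union (gridPreimage g K) ((stdGrid d n).trunc (d - 1)) =
    union (boxdot i hi) ((stdGrid d n).trunc (d - 1))

/-- `F` is a `(K, J)`-fillable subshape of `I`. -/
noncomputable def IsFillable (I K J F : PastingShape d) : Prop :=
  ∃ hFI : F ≤ I,
    F.trunc (d - 1) = F ∨
    ∃ (n : Vtx d) (f : Hom (stdGrid d n) F), IsShaping f ∧
      ((∀ p ∈ (stdGrid d n).boxes, (f.vApp p.1, f.vApp p.2) ∈ K.boxes) ∨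
       ∃ (i : Hom (stdGrid d (fun _ => 1)) (stdGrid d n)) (hi : Function.Injective i.toFun),
         IsDivPairMap K J ((inclHom hFI).comp f) i hi)

/-- Ordered values of a monotone map on a linear order have ordered preimages. -/
theorem exists_le_of_mem_range_of_le {α β : Type*} [LinearOrder α] [PartialOrder β]
    {f : α → β} (hf : Monotone f) {u v : β} (hu : u ∈ Set.range f) (hv : v ∈ Set.range f)
    (huv : u ≤ v) : ∃ i j, i ≤ j ∧ f i = u ∧ f j = v := by
  obtain ⟨i, rfl⟩ := hu
  obtain ⟨j, rfl⟩ := hv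
  rcases le_total i j with h | h
  · exact ⟨i, j, h, rfl, rfl⟩
  · exact ⟨j, j, le_rfl, le_antisymm (hf h) huv, rfl⟩

theorem box_mem_of_mem_gcptRange {n : Vtx d} {I : PastingShape d} (f : Hom (stdGrid d n) I)
    {x y : Vtx d} (hxy : IsBoxPair x y) (h : ∀ a, x a ∈ gcptRange f a ∧ y a ∈ gcptRange f a) :
    (x, y) ∈ I.boxes := by
  choose i j hij hi hj using fun a =>
    exists_le_of_mem_range_of_le (gcpt_mono f a) (h a).1 (h a).2 (hxy a)
  have hbox : ((fun a => (i a : ℕ)), (fun a => (j a : ℕ))) ∈ (stdGrid d n).boxes :=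
    fun a => ⟨hij a, Nat.lt_succ_iff.mp (j a).isLt⟩
  have hx : (f.toFun ⟨_, fst_mem_vertices hbox⟩ : Vtx d) = x :=
    funext fun a => (grid_apply f _ a).trans (hi a)
  have hy : (f.toFun ⟨_, snd_mem_vertices hbox⟩ : Vtx d) = y :=
    funext fun a => (grid_apply f _ a).trans (hj a)
  have hmem := f.map_box ⟨_, fst_mem_vertices hbox⟩ ⟨_, snd_mem_vertices hbox⟩ hbox
  rwa [hx, hy] at hmem

/-- The tuple of components of a map out of a standard grid. -/
def Hom.toTuple {n : Vtx d} {I : PastingShape d} (f : Hom (stdGrid d n) I) : TupleHom n I :=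
  ⟨gcpt f, gcpt_mono f, fun _ _ hxy h => box_mem_of_mem_gcptRange f hxy h⟩

/-- The map out of a standard grid with given components. -/
def TupleHom.toHom {n : Vtx d} {I : PastingShape d} (F : TupleHom n I) :
    Hom (stdGrid d n) I where
  toFun x := ⟨fun a => F.1 a ⟨(x : Vtx d) a,
      Nat.lt_succ_of_le (mem_stdGrid_vertices.mp x.2 a)⟩,
    F.2.2 _ _ (fun _ => le_rfl) fun _ => ⟨Set.mem_range_self _, Set.mem_range_self _⟩⟩
  map_box _ _ h := F.2.2 _ _ (fun a => F.2.1 a (h a).1)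
    fun _ => ⟨Set.mem_range_self _, Set.mem_range_self _⟩
  map_deg _ _ _ a ha := congrArg (F.1 a) (Fin.ext ha)

theorem TupleHom.gcpt_toHom {n : Vtx d} {I : PastingShape d} (F : TupleHom n I) (a : Fin d)
    (i : Fin (n a + 1)) : gcpt F.toHom a i = F.1 a i :=
  congrArg (F.1 a) (Fin.ext (by simp [unitVtx]))

/-- Maps out of a standard grid correspond to tuples of monotone maps. -/
def tupleEquiv (n : Vtx d) (I : PastingShape d) : Hom (stdGrid d n) I ≃ TupleHom n I where
  toFun := Hom.toTuple
  invFun := TupleHom.toHom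
  left_inv f := Hom.ext <| funext fun x => Subtype.ext <| funext fun a => (grid_apply f x a).symm
  right_inv F := Subtype.ext <| funext fun a => funext fun i => F.gcpt_toHom a i

theorem gcpt_comp_gridOfMono {m n : Vtx d} {I : PastingShape d}
    (φ : ∀ a, Fin (m a + 1) →o Fin (n a + 1)) (f : Hom (stdGrid d n) I) (a : Fin d)
    (i : Fin (m a + 1)) : gcpt (f.comp (gridOfMono φ)) a i = gcpt f a (φ a i) := by
  refine (grid_apply f _ a).trans (congrArg (gcpt f a) (Fin.ext ?_))
  exact congrArg (fun j => (φ a j : ℕ)) (Fin.ext (by simp [unitVtx]))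

/-- For a `d`-dimensional pasting shape `I` the assignment
`f ↦ (f_1, …, f_d)`, `f_a(i) = f(0,…,0,i,0,…,0)_a`, is a bijection from the set of maps
of pasting shapes `□[n_1,…,n_d] → I` onto `Hom_I(⊔_a [n_a], ℕ)`, naturally in
`([n_1],…,[n_d]) ∈ Δ^{×d}`; moreover every such `f` satisfies
`f(x) = (f_1(x_1),…,f_d(x_d))`. -/
theorem maps_from_grid_equiv_tuples (d : ℕ) (I : PastingShape d) :
    ∃ e : ∀ n : Vtx d, Hom (stdGrid d n) I ≃ TupleHom n I,
      (∀ (n : Vtx d) (σ : Hom (stdGrid d n) I) (a : Fin d) (i : Fin (n a + 1)),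
        (e n σ).1 a i = gcpt σ a i) ∧
      (∀ (m n : Vtx d) (φ : ∀ a, Fin (m a + 1) →o Fin (n a + 1))
          (σ : Hom (stdGrid d n) I) (a : Fin d) (i : Fin (m a + 1)),
        (e m (σ.comp (gridOfMono φ))).1 a i = (e n σ).1 a (φ a i)) ∧
      (∀ (n : Vtx d) (σ : Hom (stdGrid d n) I) (x : (stdGrid d n).vertices) (a : Fin d),
        (σ.toFun x : Vtx d) a =
          (e n σ).1 a ⟨(x : Vtx d) a, Nat.lt_succ_of_le (mem_stdGrid_vertices.mp x.2 a)⟩) :=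
  ⟨fun n => tupleEquiv n I, fun _ _ _ _ => rfl,
    fun _ _ φ σ a i => gcpt_comp_gridOfMono φ σ a i, fun _ σ x a => grid_apply σ x a⟩

end Pasting
end

section
/- For every d-dimensional pasting shape I, every tuple (n_1,…,n_d) ∈ ℕ^d and every index 1 ≤ a ≤ d, a map of pasting shapes □[n_1,…,n_d] → I is uniquely determined by its restrictions along the inert inclusions □[n_1,…,n_{a−1},1,n_{a+1},…,n_d] → □[n_1,…,n_d] hitting the consecutive unit intervals {i−1 ≤ i} ⊂ [n_a] (i = 1,…,n_a), and conversely every family of such restrictions that agrees on the overlaps □[n_1,…,0,…,n_d] glues to a (unique) map □[n_1,…,n_d] → I. Equivalently, the Segal map [I]_{n_1,…,n_d} → [I]_{n_1,…,1,…,n_d} ×_{[I]_{n_1,…,0,…,n_d}} ⋯ ×_{[I]_{n_1,…,0,…,n_d}} [I]_{n_1,…,1,…,n_d} is a bijection in each coordinate a; in particular the nerve [I] is a d-uple Segal set. -/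
namespace Pasting

variable {d : ℕ}

open PastingShape

theorem Hom.vApp_of_mem {I J : PastingShape d} (f : Hom I J) {x : Vtx d}
    (hx : x ∈ I.vertices) : f.vApp x = f.toFun ⟨x, hx⟩ :=
  dif_pos hx

theorem Hom.ext_vApp {I J : PastingShape d} {f g : Hom I J}
    (h : ∀ x ∈ I.vertices, f.vApp x = g.vApp x) : f = g := by
  refine Hom.ext (funext fun x => Subtype.ext ?_)
  simpa only [Hom.vApp_of_mem _ x.2] using h x x.2

theorem Hom.vApp_comp {I J K : PastingShape d} (g : Hom J K) (f : Hom I J) {x : Vtx d}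
    (hx : x ∈ I.vertices) : (g.comp f).vApp x = g.vApp (f.vApp x) := by
  rw [Hom.vApp_of_mem _ hx, Hom.vApp_of_mem f hx, Hom.vApp_of_mem g (f.toFun ⟨x, hx⟩).2]
  rfl

theorem edgeHom_vApp {n : Vtx d} {a : Fin d} {i : ℕ} (hi : i + 1 ≤ n a) {x : Vtx d}
    (hx : x ∈ (stdGrid d (Function.update n a 1)).vertices) :
    (edgeHom n a i hi).vApp x = Function.update x a (x a + i) := by
  rw [Hom.vApp_of_mem _ hx]
  funext b
  by_cases hb : b = a
  · subst hb
    simp [edgeHom]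
  · simp [edgeHom, hb]

theorem capHom_vApp {n : Vtx d} {a : Fin d} {e : ℕ} (he : e ≤ 1) {x : Vtx d}
    (hx : x ∈ (stdGrid d (Function.update n a 0)).vertices) :
    (capHom n a e he).vApp x = Function.update x a e := by
  rw [Hom.vApp_of_mem _ hx]
  funext b
  by_cases hb : b = a
  · subst hb
    simp [capHom]
  · simp [capHom, hb]

theorem update_mem_stdGrid_boxes {n x y : Vtx d} (h : (x, y) ∈ (stdGrid d n).boxes)
    (a : Fin d) {k l m : ℕ} (hkl : k ≤ l) (hlm : l ≤ m) :
    (Function.update x a k, Function.update y a l) ∈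
      (stdGrid d (Function.update n a m)).boxes := by
  intro b
  by_cases hb : b = a
  · subst hb
    simpa using ⟨hkl, hlm⟩
  · simpa [hb] using h b

theorem update_mem_stdGrid_vertices {n x : Vtx d} (h : x ∈ (stdGrid d n).vertices)
    (a : Fin d) {k m : ℕ} (hkm : k ≤ m) :
    Function.update x a k ∈ (stdGrid d (Function.update n a m)).vertices :=
  update_mem_stdGrid_boxes h a le_rfl hkm

/-- A form of join closure which also allows degenerate boxes in the direction of the join. -/
theorem PastingShape.join_mem (I : PastingShape d) (a : Fin d) {p q' p' q : Vtx d}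
    (h : (p, q') ∈ I.boxes) (h' : (p', q) ∈ I.boxes)
    (hp : ∀ b, b ≠ a → p b = p' b) (hq : ∀ b, b ≠ a → q' b = q b) (ha : q' a = p' a) :
    (p, q) ∈ I.boxes := by
  by_cases h1 : p a = q' a
  · have hpp : p = p' := funext fun b => by
      by_cases hb : b = a
      · rw [hb, h1, ha]
      · exact hp b hb
    rwa [hpp]
  by_cases h2 : p' a = q a
  · have hqq : q' = q := funext fun b => by
      by_cases hb : b = a
      · rw [hb, ha, h2]
      · exact hq b hb
    rwa [← hqq]
  have hb := I.isBox' _ h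
  have hb' := I.isBox' _ h'
  refine I.join_closed' p q' p' q h h' ⟨hb, hb', fun b => ?_, fun b c hbn hcn => ?_⟩
  · by_cases hba : b = a
    · subst hba
      exact Or.inr ⟨lt_of_le_of_ne (hb b) h1, ha, lt_of_le_of_ne (hb' b) h2⟩
    · exact Or.inl ⟨hp b hba, hq b hba⟩
  · have key : ∀ c, ¬(p c = p' c ∧ q' c = q c) → c = a := fun c hc => by
      by_contra hca
      exact hc ⟨hp c hca, hq c hca⟩
    rw [key b hbn, key c hcn]

/-- `f` sends the pair `(x, y)` to a box of `I`, preserving its degenerate directions. -/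
def MapsBox (I : PastingShape d) (f : Vtx d → Vtx d) (x y : Vtx d) : Prop :=
  (f x, f y) ∈ I.boxes ∧ ∀ b, x b = y b → f x b = f y b

theorem mapsBox_of_unit {n : Vtx d} {I : PastingShape d} {f : Vtx d → Vtx d} {a : Fin d}
    (hunit : ∀ x y : Vtx d, (x, y) ∈ (stdGrid d n).boxes → y a ≤ x a + 1 → MapsBox I f x y) :
    ∀ (k : ℕ) (x y : Vtx d), (x, y) ∈ (stdGrid d n).boxes → y a ≤ x a + k →
      MapsBox I f x y := by
  intro k
  induction k with
  | zero => exact fun x y hxy hk => hunit x y hxy (by omega)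
  | succ k ih =>
    intro x y hxy hk
    by_cases hu : y a ≤ x a + k
    · exact ih x y hxy hu
    have hya := (hxy a).2
    dsimp only at hya
    set x' := Function.update x a (x a + k)
    set y' := Function.update y a (x a + k)
    have hx'a : x' a = x a + k := Function.update_self ..
    have hy'a : y' a = x a + k := Function.update_self ..
    have hx' : ∀ b, b ≠ a → x' b = x b := fun b hb => Function.update_of_ne hb ..
    have hy' : ∀ b, b ≠ a → y' b = y b := fun b hb => Function.update_of_ne hb ..
    have mem : ∀ u v : Vtx d, (∀ b, b ≠ a → u b ≤ v b ∧ v b ≤ n b) → u a ≤ v a → v a ≤ n a →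
        (u, v) ∈ (stdGrid d n).boxes := fun u v h h1 h2 b => by
      by_cases hb : b = a
      · subst hb
        exact ⟨h1, h2⟩
      · exact h b hb
    have hle : ∀ b, x b ≤ y b ∧ y b ≤ n b := hxy
    have hxx' := ih x x' (mem _ _ (fun b hb => by have := hle b; rw [hx' b hb]; omega)
      (by omega) (by omega)) (by omega)
    have hxy' := ih x y' (mem _ _ (fun b hb => by have := hle b; rw [hy' b hb]; omega)
      (by omega) (by omega)) (by omega)
    have hx'y' := hunit x' y' (mem _ _ (fun b hb => by
      have := hle b; rw [hx' b hb, hy' b hb]; omega) (by omega) (by omega)) (by omega)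
    have hx'y := hunit x' y (mem _ _ (fun b hb => by have := hle b; rw [hx' b hb]; omega)
      (by omega) (by omega)) (by omega)
    have hy'y := hunit y' y (mem _ _ (fun b hb => by have := hle b; rw [hy' b hb]; omega)
      (by omega) (by omega)) (by omega)
    refine ⟨I.join_mem a hxy'.1 hx'y.1 (fun b hb => hxx'.2 b (hx' b hb).symm)
      (fun b hb => hy'y.2 b (hy' b hb)) (hx'y'.2 a (by omega)).symm, fun b hb => ?_⟩
    have hba : b ≠ a := by
      rintro rfl
      omega
    rw [hxy'.2 b (by rw [hy' b hba, hb]), hy'y.2 b (hy' b hba)]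

section Glue

variable {I : PastingShape d} {n : Vtx d} {a : Fin d}

/-- The map on `ℕ^d` glued from a family of maps on the unit slabs of a grid. -/
noncomputable def glue (hna : 0 < n a)
    (τ : Fin (n a) → Hom (stdGrid d (Function.update n a 1)) I) (x : Vtx d) : Vtx d :=
  if h : x a < n a then (τ ⟨x a, h⟩).vApp (Function.update x a 0)
  else (τ ⟨n a - 1, Nat.sub_one_lt_of_lt hna⟩).vApp (Function.update x a 1)

theorem vApp_update_one_eq {τ : Fin (n a) → Hom (stdGrid d (Function.update n a 1)) I}
    (hτ : ∀ (i : Fin (n a)) (h : (i : ℕ) + 1 < n a),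
      (τ i).comp (capHom n a 1 le_rfl) =
        (τ ⟨(i : ℕ) + 1, h⟩).comp (capHom n a 0 (Nat.zero_le 1)))
    {x : Vtx d} (hx : x ∈ (stdGrid d n).vertices) (i : Fin (n a)) (h : (i : ℕ) + 1 < n a) :
    (τ i).vApp (Function.update x a 1) =
      (τ ⟨(i : ℕ) + 1, h⟩).vApp (Function.update x a 0) := by
  have hm := update_mem_stdGrid_vertices hx a (le_refl 0)
  have := congrArg (fun f => Hom.vApp f (Function.update x a 0)) (hτ i h)
  simpa only [Hom.vApp_comp _ _ hm, capHom_vApp _ hm, Function.update_idem] using this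

theorem glue_eq (hna : 0 < n a) {τ : Fin (n a) → Hom (stdGrid d (Function.update n a 1)) I}
    (hτ : ∀ (i : Fin (n a)) (h : (i : ℕ) + 1 < n a),
      (τ i).comp (capHom n a 1 le_rfl) =
        (τ ⟨(i : ℕ) + 1, h⟩).comp (capHom n a 0 (Nat.zero_le 1)))
    {x : Vtx d} (hx : x ∈ (stdGrid d n).vertices) (i : Fin (n a))
    (h0 : (i : ℕ) ≤ x a) (h1 : x a ≤ i + 1) :
    glue hna τ x = (τ i).vApp (Function.update x a (x a - i)) := by
  obtain ⟨i, hi⟩ := i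
  dsimp only at h0 h1 ⊢
  unfold glue
  rcases Nat.lt_or_ge (x a) (i + 1) with h | h
  · obtain rfl : i = x a := by omega
    rw [dif_pos hi, Nat.sub_self]
  · have hxi : x a = i + 1 := by omega
    have hsub : x a - i = 1 := by omega
    rw [hsub]
    split_ifs with hlt
    · have hlt' : i + 1 < n a := hxi ▸ hlt
      rw [vApp_update_one_eq hτ hx ⟨i, hi⟩ hlt']
      congr 3
    · have hn : n a - 1 = i := by omega
      congr 3

theorem glue_mapsBox (hna : 0 < n a)
    {τ : Fin (n a) → Hom (stdGrid d (Function.update n a 1)) I}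
    (hτ : ∀ (i : Fin (n a)) (h : (i : ℕ) + 1 < n a),
      (τ i).comp (capHom n a 1 le_rfl) =
        (τ ⟨(i : ℕ) + 1, h⟩).comp (capHom n a 0 (Nat.zero_le 1)))
    {x y : Vtx d} (hxy : (x, y) ∈ (stdGrid d n).boxes) : MapsBox I (glue hna τ) x y := by
  refine mapsBox_of_unit (a := a) (fun x y hxy hk => ?_) (y a) x y hxy (by omega)
  have hle : x a ≤ y a ∧ y a ≤ n a := hxy a
  obtain ⟨i, hi, h0, h1⟩ : ∃ i, i < n a ∧ i ≤ x a ∧ y a ≤ i + 1 := by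
    by_cases h : x a < n a
    · exact ⟨x a, h, le_rfl, hk⟩
    · exact ⟨n a - 1, by omega, by omega, by omega⟩
  have hb := update_mem_stdGrid_boxes hxy a (k := x a - i) (l := y a - i) (m := 1)
    (by omega) (by omega)
  rw [MapsBox, glue_eq hna hτ (fst_mem_vertices hxy) ⟨i, hi⟩ h0 (by dsimp only; omega),
    glue_eq hna hτ (snd_mem_vertices hxy) ⟨i, hi⟩ (by dsimp only; omega) h1]
  refine ⟨(τ ⟨i, hi⟩).vApp_box hb, fun b hbe =>
    vApp_coord_eq _ (fst_mem_vertices hb) (snd_mem_vertices hb) b ?_⟩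
  by_cases hba : b = a
  · subst hba
    simp [hbe]
  · simp [hba, hbe]

/-- The map of pasting shapes glued from a compatible family of maps on the unit slabs. -/
noncomputable def glueHom (hna : 0 < n a)
    (τ : Fin (n a) → Hom (stdGrid d (Function.update n a 1)) I)
    (hτ : ∀ (i : Fin (n a)) (h : (i : ℕ) + 1 < n a),
      (τ i).comp (capHom n a 1 le_rfl) =
        (τ ⟨(i : ℕ) + 1, h⟩).comp (capHom n a 0 (Nat.zero_le 1))) :
    Hom (stdGrid d n) I where
  toFun x := ⟨glue hna τ x, (glue_mapsBox hna hτ x.2).1⟩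
  map_box _ _ h := (glue_mapsBox hna hτ h).1
  map_deg _ _ h := (glue_mapsBox hna hτ h).2

theorem glueHom_comp_edgeHom (hna : 0 < n a)
    (τ : Fin (n a) → Hom (stdGrid d (Function.update n a 1)) I)
    (hτ : ∀ (i : Fin (n a)) (h : (i : ℕ) + 1 < n a),
      (τ i).comp (capHom n a 1 le_rfl) =
        (τ ⟨(i : ℕ) + 1, h⟩).comp (capHom n a 0 (Nat.zero_le 1)))
    (i : Fin (n a)) : (glueHom hna τ hτ).comp (edgeHom n a i i.isLt) = τ i := by
  refine Hom.ext_vApp fun x hx => ?_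
  have hxa : x a ≤ 1 := by simpa using mem_stdGrid_vertices.mp hx a
  have hm : (edgeHom n a i i.isLt).vApp x ∈ (stdGrid d n).vertices :=
    (edgeHom n a i i.isLt).vApp_box hx
  rw [Hom.vApp_comp _ _ hx, Hom.vApp_of_mem _ hm]
  change glue hna τ ((edgeHom n a i i.isLt).vApp x) = _
  rw [edgeHom_vApp i.isLt hx] at hm ⊢
  rw [glue_eq hna hτ hm i (by simp) (by simp; omega)]
  simp

theorem edge_restriction_injective (hna : 0 < n a) :
    Function.Injective (fun (σ : Hom (stdGrid d n) I) (i : Fin (n a)) =>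
      σ.comp (edgeHom n a i i.isLt)) := by
  intro σ σ' h
  refine Hom.ext_vApp fun x hx => ?_
  have hxa := mem_stdGrid_vertices.mp hx a
  obtain ⟨i, hi, h0, h1⟩ : ∃ i, i < n a ∧ i ≤ x a ∧ x a ≤ i + 1 := by
    by_cases h : x a < n a
    · exact ⟨x a, h, le_rfl, by omega⟩
    · exact ⟨n a - 1, by omega, by omega, by omega⟩
  have hm := update_mem_stdGrid_vertices hx a (k := x a - i) (m := 1) (by omega)
  have := congrArg (fun f => Hom.vApp f (Function.update x a (x a - i))) (congrFun h ⟨i, hi⟩)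
  simpa [Hom.vApp_comp _ _ hm, edgeHom_vApp hi hm, Nat.sub_add_cancel h0] using this

theorem edgeHom_comp_capHom (i : ℕ) (hi : i + 1 < n a) :
    (edgeHom n a i hi.le).comp (capHom n a 1 le_rfl) =
      (edgeHom n a (i + 1) hi).comp (capHom n a 0 (Nat.zero_le 1)) := by
  refine Hom.ext (funext fun x => Subtype.ext (funext fun b => ?_))
  by_cases hb : b = a <;> simp [Hom.comp, edgeHom, capHom, hb, add_comm]

end Glue

/-- A map of pasting shapes `□[n_1,…,n_d] → I` is uniquely determined
by its restrictions along the inert inclusions hitting the consecutive unit intervals of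
`[n_a]`, and every family of such restrictions agreeing on overlaps glues uniquely:
the Segal map of the nerve `[I]` is a bijection in each coordinate, so `[I]` is a
`d`-uple Segal set. -/
theorem nerve_is_segal (d : ℕ) (I : PastingShape d) (n : Vtx d) (a : Fin d)
    (hna : 0 < n a) :
    Function.Injective (fun (σ : Hom (stdGrid d n) I) (i : Fin (n a)) =>
      σ.comp (edgeHom n a i i.isLt)) ∧
    ∀ τ : Fin (n a) → Hom (stdGrid d (Function.update n a 1)) I,
      (∀ (i : Fin (n a)) (h : (i : ℕ) + 1 < n a),
        (τ i).comp (capHom n a 1 le_rfl) =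
          (τ ⟨(i : ℕ) + 1, h⟩).comp (capHom n a 0 (Nat.zero_le 1))) ↔
      ∃ σ : Hom (stdGrid d n) I, ∀ i : Fin (n a), σ.comp (edgeHom n a i i.isLt) = τ i := by
  refine ⟨edge_restriction_injective hna, fun τ =>
    ⟨fun hτ => ⟨glueHom hna τ hτ, glueHom_comp_edgeHom hna τ hτ⟩, ?_⟩⟩
  rintro ⟨σ, hσ⟩ i h
  rw [← hσ i, ← hσ ⟨(i : ℕ) + 1, h⟩]
  exact congrArg σ.comp (edgeHom_comp_capHom (i : ℕ) h)

end Pasting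
end

section
/- The nerve functor for d-dimensional pasting shapes is fully faithful: for any two d-dimensional pasting shapes I and J, the map induced by the nerve from the set of maps of pasting shapes I → J to the set of morphisms of d-uple simplicial sets (natural transformations) [I] → [J] is a bijection. -/
namespace Pasting

variable {d : ℕ}

open PastingShape

/-- The simplex of the nerve that is constant at a vertex. -/
def constHom {I : PastingShape d} (m : Vtx d) (x : I.vertices) : Hom (stdGrid d m) I where
  toFun _ := x
  map_box _ _ _ := x.2
  map_deg _ _ _ _ _ := rfl

/-- The inclusion of a vertex of a standard grid, as a tuple of monotone maps. -/
def vertexMono {n : Vtx d} (m : Vtx d) (v : (stdGrid d n).vertices) (a : Fin d) :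
    Fin (m a + 1) →o Fin (n a + 1) :=
  OrderHom.const _ ⟨(v : Vtx d) a, Nat.lt_succ_of_le (mem_stdGrid_vertices.mp v.2 a)⟩

theorem comp_vertexMono {n : Vtx d} {I : PastingShape d} (m : Vtx d)
    (σ : Hom (stdGrid d n) I) (v : (stdGrid d n).vertices) :
    σ.comp (gridOfMono (vertexMono m v)) = constHom m (σ.toFun v) := rfl

/-- The origin of a standard grid. -/
def gridZero (n : Vtx d) : (stdGrid d n).vertices :=
  ⟨0, mem_stdGrid_vertices.mpr fun _ => Nat.zero_le _⟩

/-- The terminal vertex of a standard grid. -/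
def gridTop (n : Vtx d) : (stdGrid d n).vertices :=
  ⟨n, mem_stdGrid_vertices.mpr fun _ => le_rfl⟩

/-- The simplex `□[1,…,1] → I` determined by a box of `I`. -/
def boxHom {I : PastingShape d} {x y : Vtx d} (h : (x, y) ∈ I.boxes) :
    Hom (stdGrid d (fun _ => 1)) I where
  toFun v := ⟨fun a => if (v : Vtx d) a = 0 then x a else y a,
    I.face_closed' _ h _ _ ⟨fun a => by dsimp only; split_ifs <;> simp, fun _ => le_rfl⟩⟩
  map_box := by
    intro v w hvw
    refine I.face_closed' _ h _ _ ⟨fun a => ?_, fun a => ?_⟩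
    · constructor <;> dsimp only <;> split_ifs <;> simp
    · have hle : (v : Vtx d) a ≤ (w : Vtx d) a := (hvw a).1
      have hxy : x a ≤ y a := I.isBox' _ h a
      dsimp only
      split_ifs <;> omega
  map_deg := by
    intro v w _ a ha
    simp only [ha]

theorem boxHom_zero {I : PastingShape d} {x y : Vtx d} (h : (x, y) ∈ I.boxes) :
    (boxHom h).toFun (gridZero _) = ⟨x, fst_mem_vertices h⟩ := rfl

theorem boxHom_top {I : PastingShape d} {x y : Vtx d} (h : (x, y) ∈ I.boxes) :
    (boxHom h).toFun (gridTop _) = ⟨y, snd_mem_vertices h⟩ := rfl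

/-- The endomorphism of `□[1,…,1]` collapsing direction `a` onto `0`. -/
def collapseMono (a b : Fin d) : Fin (1 + 1) →o Fin (1 + 1) :=
  if b = a then OrderHom.const _ 0 else OrderHom.id

theorem boxHom_comp_collapse {I : PastingShape d} {x y : Vtx d} (h : (x, y) ∈ I.boxes)
    {a : Fin d} (ha : x a = y a) :
    (boxHom h).comp (gridOfMono (m := fun _ => 1) (n := fun _ => 1) (collapseMono a)) =
      boxHom h := by
  refine Hom.ext (funext fun v => Subtype.ext (funext fun b => ?_))
  by_cases hb : b = a
  · subst hb
    simp [Hom.comp, boxHom, ha]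
  · simp [Hom.comp, boxHom, gridOfMono, collapseMono, hb]

namespace NerveHom

variable {I J : PastingShape d}

theorem ext {η θ : NerveHom I J} (h : η.app = θ.app) : η = θ := by
  cases η; cases θ; cases h; rfl

/-- The map on vertices induced by a morphism of nerves. -/
def onVertex (η : NerveHom I J) (x : I.vertices) : J.vertices :=
  (η.app 0 (constHom 0 x)).toFun (gridZero 0)

theorem onVertex_apply (η : NerveHom I J) {n : Vtx d} (σ : Hom (stdGrid d n) I)
    (v : (stdGrid d n).vertices) : η.onVertex (σ.toFun v) = (η.app n σ).toFun v := by
  rw [onVertex, ← comp_vertexMono, η.naturality, comp_vertexMono]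
  rfl

/-- The map of pasting shapes induced by a morphism of nerves. -/
def toHom (η : NerveHom I J) : Hom I J where
  toFun := η.onVertex
  map_box := by
    intro x y h
    have h₀ := η.onVertex_apply (boxHom h) (gridZero _)
    have h₁ := η.onVertex_apply (boxHom h) (gridTop _)
    rw [boxHom_zero] at h₀
    rw [boxHom_top] at h₁
    rw [h₀, h₁]
    exact (η.app _ (boxHom h)).map_box _ _ fun a => ⟨Nat.zero_le _, le_rfl⟩
  map_deg := by
    intro x y h a ha
    have h₀ := η.onVertex_apply (boxHom h) (gridZero _)
    have h₁ := η.onVertex_apply (boxHom h) (gridTop _)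
    rw [boxHom_zero] at h₀
    rw [boxHom_top, ← boxHom_comp_collapse h ha, η.naturality] at h₁
    rw [h₀, h₁]
    refine (η.app _ (boxHom h)).map_deg _ _ (fun b => ⟨Nat.zero_le _, ?_⟩) a ?_
    · exact Nat.lt_succ_iff.mp (Fin.isLt _)
    · simp [gridZero, gridOfMono, collapseMono]

theorem nerveMap_toHom (η : NerveHom I J) : nerveMap η.toHom = η :=
  ext (funext fun _ => funext fun σ => Hom.ext (funext fun v => η.onVertex_apply σ v))

end NerveHom

theorem toHom_nerveMap {I J : PastingShape d} (g : Hom I J) : (nerveMap g).toHom = g := rfl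

/-- The nerve functor for `d`-dimensional pasting shapes is fully
faithful: the induced map from maps of pasting shapes `I → J` to morphisms of `d`-uple
simplicial sets `[I] → [J]` is a bijection. -/
theorem nerve_fully_faithful (d : ℕ) (I J : PastingShape d) :
    Function.Bijective (fun g : Hom I J => nerveMap g) := by
  exact Function.bijective_iff_has_inverse.mpr
    ⟨NerveHom.toHom, toHom_nerveMap, NerveHom.nerveMap_toHom⟩

end Pasting
end
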